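/- Let K be a field of odd characteristic p. Then Der_K(K[X]/(X^p)), the Lie algebra of K-derivations of the truncated polynomial algebra K[X]/(X^p) with the commutator bracket, is a simple Lie algebra (the Jacobson–Witt algebra W(1;1)). -/

import Mathlib

set_option synthInstance.maxHeartbeats 1000000
set_option maxHeartbeats 1000000

/-- The truncated polynomial algebra `K[X]/(X^n)`. -/
abbrev TruncPoly (K : Type) [Field K] (n : ℕ) : Type :=
  Polynomial K ⧸ Ideal.span {(Polynomial.X : Polynomial K) ^ n}

/-- The image `x` of `X` in `K[X]/(X^n)`. -/
noncomputable abbrev truncX (K : Type) [Field K] (n : ℕ) : TruncPoly K n :=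
  Ideal.Quotient.mk _ (Polynomial.X : Polynomial K)

namespace Derivation

variable {R A : Type*} [CommRing R] [CommRing A] [Algebra R A]

theorem smul_lie_smul_self (D : Derivation R A A) (a b : A) :
    ⁅a • D, b • D⁆ = (a * D b - b * D a) • D := by
  ext c
  simp only [commutator_apply, smul_apply, smul_eq_mul, leibniz]
  ring

theorem lie_smul_self (D : Derivation R A A) (a : A) : ⁅D, a • D⁆ = D a • D := by
  simp

theorem iterate_apply_smul_mem {D : Derivation R A A} {I : LieIdeal R (Derivation R A A)} {a : A}
    (h : a • D ∈ I) (n : ℕ) : (D^[n] a) • D ∈ I := by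
  induction n with
  | zero => exact h
  | succ n ih =>
    rw [Function.iterate_succ_apply', ← lie_smul_self]
    exact lie_mem_right R _ I _ _ ih

/-- If `D x = 1` and `2` is invertible, every Lie ideal containing `D` contains `A • D`. -/
theorem smul_mem_of_mem {D : Derivation R A A} {I : LieIdeal R (Derivation R A A)} {x : A}
    (h2 : IsUnit (2 : R)) (hx : D x = 1) (hD : D ∈ I) (a : A) : a • D ∈ I := by
  have apply_smul_mem (b : A) : D b • D ∈ I := by
    rw [← lie_smul_self]
    exact lie_mem_left R _ I _ _ hD
  have mem_of_two_smul {E : Derivation R A A} (hE : (2 : R) • E ∈ I) : E ∈ I := by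
    obtain ⟨u, hu⟩ := h2
    rw [← hu] at hE
    simpa [← Units.smul_def] using I.smul_mem (↑u⁻¹ : R) hE
  have x_smul_mem : x • D ∈ I := by
    refine mem_of_two_smul ?_
    have := apply_smul_mem (x * x)
    rwa [leibniz, hx, smul_eq_mul, mul_one, add_smul, ← two_smul R] at this
  refine mem_of_two_smul ?_
  have := I.sub_mem (apply_smul_mem (x * a))
    (lie_mem_left R _ I _ (a • D) x_smul_mem)
  rw [smul_lie_smul_self, ← sub_smul, leibniz, hx] at this
  have key : (2 : R) • a • D = (x • D a + a • 1 - (x * D a - a * 1)) • D := by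
    rw [two_smul, ← add_smul]
    congr 1
    simp only [smul_eq_mul]
    ring
  rwa [key]

end Derivation

open Polynomial in
theorem Polynomial.iterate_derivative_natDegree {R : Type*} [CommRing R] (f : R[X]) :
    derivative^[f.natDegree] f = C (f.natDegree.factorial * f.leadingCoeff) := by
  have h : (derivative^[f.natDegree] f).natDegree = 0 := by
    simpa using natDegree_iterate_derivative f f.natDegree
  rw [eq_C_of_natDegree_eq_zero h, coeff_iterate_derivative]
  simp [Nat.descFactorial_self]

namespace TruncPoly

open Polynomial

theorem nontrivial (K : Type) [Field K] {p : ℕ} (hp : p.Prime) : Nontrivial (TruncPoly K p) := by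
  refine Ideal.Quotient.nontrivial_iff.mpr fun h => ?_
  rw [Ideal.span_singleton_eq_top, isUnit_pow_iff hp.ne_zero] at h
  exact not_isUnit_X h

variable (K : Type) [Field K] (p : ℕ) [CharP K p]

theorem mkₐ_derivative_eq_zero (f : K[X])
    (hf : Ideal.Quotient.mkₐ K (Ideal.span {(X : K[X]) ^ p}) f = 0) :
    Ideal.Quotient.mkₐ K (Ideal.span {(X : K[X]) ^ p}) (derivative' f) = 0 := by
  rw [Ideal.Quotient.mkₐ_eq_mk, Ideal.Quotient.eq_zero_iff_mem,
    Ideal.mem_span_singleton] at hf ⊢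
  obtain ⟨g, rfl⟩ := hf
  simp [derivative']

/-- The derivation of `K[X]/(X^p)` induced by `d/dX`, in characteristic `p`. -/
noncomputable def ddx : Derivation K (TruncPoly K p) (TruncPoly K p) :=
  Derivation.liftOfSurjective (Ideal.Quotient.mkₐ_surjective K _) (mkₐ_derivative_eq_zero K p)

theorem ddx_mk (f : K[X]) :
    ddx K p (Ideal.Quotient.mk _ f) = Ideal.Quotient.mk _ (derivative f) :=
  Derivation.liftOfSurjective_apply (Ideal.Quotient.mkₐ_surjective K _)
    (mkₐ_derivative_eq_zero K p) f

theorem ddx_truncX : ddx K p (truncX K p) = 1 := by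
  rw [ddx_mk, derivative_X, map_one]

theorem iterate_ddx_mk (f : K[X]) (n : ℕ) :
    (ddx K p)^[n] (Ideal.Quotient.mk _ f) = Ideal.Quotient.mk _ (derivative^[n] f) := by
  induction n with
  | zero => rfl
  | succ n ih => rw [Function.iterate_succ_apply', Function.iterate_succ_apply', ih, ddx_mk]

theorem eq_smul_ddx (E : Derivation K (TruncPoly K p) (TruncPoly K p)) :
    E = E (truncX K p) • ddx K p := by
  have h : E.compAlgebraMap K[X] = (E (truncX K p) • ddx K p).compAlgebraMap K[X] := by
    refine derivation_ext ?_
    change E (truncX K p) = E (truncX K p) • ddx K p (truncX K p)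
    rw [ddx_truncX, smul_eq_mul, mul_one]
  ext a
  obtain ⟨f, rfl⟩ := Ideal.Quotient.mk_surjective a
  exact Derivation.congr_fun h f

theorem exists_iterate_ddx_eq_algebraMap (hp : p.Prime) {a : TruncPoly K p} (ha : a ≠ 0) :
    ∃ (n : ℕ) (c : K), c ≠ 0 ∧ (ddx K p)^[n] a = algebraMap K _ c := by
  obtain ⟨g, rfl⟩ := Ideal.Quotient.mk_surjective a
  set f := g %ₘ X ^ p with hf
  have hgf : Ideal.Quotient.mk (Ideal.span {(X : K[X]) ^ p}) g = Ideal.Quotient.mk _ f := by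
    rw [Ideal.Quotient.mk_eq_mk_iff_sub_mem, Ideal.mem_span_singleton]
    exact ⟨g /ₘ X ^ p, by rw [sub_eq_iff_eq_add', hf, modByMonic_add_div]⟩
  have hf0 : f ≠ 0 := by
    intro h
    rw [hgf, h, map_zero] at ha
    exact ha rfl
  have hdeg : f.natDegree < p := by
    have := natDegree_modByMonic_lt g (monic_X_pow (R := K) p)
      (fun h => hp.ne_zero (by simpa using congrArg natDegree h))
    simpa using this
  refine ⟨f.natDegree, f.natDegree.factorial * f.leadingCoeff, mul_ne_zero ?_ ?_, ?_⟩
  · rw [Ne, CharP.cast_eq_zero_iff K p, hp.dvd_factorial]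
    exact not_le.mpr hdeg
  · exact leadingCoeff_ne_zero.mpr hf0
  · rw [hgf, iterate_ddx_mk, iterate_derivative_natDegree]
    rfl

end TruncPoly

open TruncPoly in
/-- Over a field of odd characteristic `p`, the Lie algebra of derivations of
`K[X]/(X^p)` (the Jacobson–Witt algebra `W(1;1)`) is simple. -/
theorem derivations_truncPoly_simple (K : Type) [Field K] (p : ℕ) [CharP K p]
    (hp : p.Prime) (hodd : Odd p) :
    LieAlgebra.IsSimple K (Derivation K (TruncPoly K p) (TruncPoly K p)) := by
  have := nontrivial K hp
  have h2 : (2 : K) ≠ 0 := by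
    intro h
    have hdvd : p ∣ 2 := (CharP.cast_eq_zero_iff K p 2).mp (mod_cast h)
    rw [(Nat.prime_dvd_prime_iff_eq hp Nat.prime_two).mp hdvd] at hodd
    exact absurd hodd (by decide)
  refine ⟨fun I => or_iff_not_imp_left.mpr fun hI => ?_, fun hab => ?_⟩
  · rw [LieSubmodule.eq_bot_iff] at hI
    push Not at hI
    obtain ⟨E, hE, hE0⟩ := hI
    rw [eq_smul_ddx K p E] at hE
    have ha : E (truncX K p) ≠ 0 := by
      intro h
      refine hE0 (Derivation.ext fun a => ?_)
      rw [eq_smul_ddx K p E, h]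
      exact zero_mul _
    obtain ⟨n, c, hc, hn⟩ := exists_iterate_ddx_eq_algebraMap K p hp ha
    have hmem := Derivation.iterate_apply_smul_mem hE n
    rw [hn, algebraMap_smul] at hmem
    have hD : ddx K p ∈ I := by
      simpa [smul_smul, hc] using I.smul_mem c⁻¹ hmem
    refine eq_top_iff.mpr fun F _ => ?_
    rw [eq_smul_ddx K p F]
    exact Derivation.smul_mem_of_mem h2.isUnit (ddx_truncX K p) hD _
  · have h := hab.trivial (ddx K p) (truncX K p • ddx K p)
    rw [Derivation.lie_smul_self, ddx_truncX, one_smul] at h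
    have h1 := ddx_truncX K p
    rw [h, Derivation.zero_apply] at h1
    exact zero_ne_one h1
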